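/- Let L(s) = ∑_{n=0}^∞ a_n e^{-λ_n s} with 0 = λ_0 < λ_1 < λ_2 < ⋯, ∑_{n=0}^∞ |a_n|² < ∞, and suppose e^{-σ₁(λ_n+λ_m)} ≤ C|λ_n − λ_m| for all n ≠ m and all σ₁ ≥ σ. Then for every D > 0 and every σ₁ ≥ σ: ∫_0^D |L(σ₁+it)|² dt ≤ (D + 3πC) · ∑_{n=0}^∞ |a_n|². -/

import Mathlib

open Finset ComplexConjugate in
/-- The Montgomery–Vaughan argument: an eigenvalue of the generalized Hilbert matrix is bounded by
the row sums of an associated positive matrix. -/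
lemma normSq_eigenvalue_le {ι : Type*} [Fintype ι] (x w : ι → ℝ)
    (hx : Function.Injective x) (hw : ∀ i, 0 < w i) {B : ℝ}
    (hB : ∀ m, ∑ k, w k ^ 2 * (2 * w m ^ 2 + w k ^ 2) * ((x m - x k)⁻¹) ^ 2 ≤ B)
    (u : ι → ℂ) (hu : u ≠ 0) (c : ℂ) (hc : conj c = -c)
    (h : ∀ n, ∑ m, ((w n * w m * (x n - x m)⁻¹ : ℝ) : ℂ) * u m = c * u n) :
    Complex.normSq c ≤ B := by
  classical
  set g : ι → ι → ℝ := fun n m => (x n - x m)⁻¹ with hg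
  have hganti : ∀ n m, g n m = - g m n := fun n m => by
    simp only [hg]; rw [← neg_sub, inv_neg]
  have hgid : ∀ n m k, g n m * g n k = (if m = k then g n m ^ 2 else 0)
      + g m k * (g n m - g n k)
      + ((if n = m then g m k ^ 2 else 0) + (if n = k then g m k ^ 2 else 0)) := by
    intro n m k
    by_cases hmk : m = k
    · subst hmk; simp [hg, -inv_pow]; ring
    by_cases hnm : n = m
    · subst hnm; simp [hmk, hg, -inv_pow]; ring
    by_cases hnk : n = k
    · subst hnk; simp [hmk, hnm, hg, -inv_pow]
      rw [← neg_sub (x m) (x n), inv_neg]; ring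
    · have h1 : x n - x m ≠ 0 := sub_ne_zero.2 (fun e => hnm (hx e))
      have h2 : x n - x k ≠ 0 := sub_ne_zero.2 (fun e => hnk (hx e))
      have h3 : x m - x k ≠ 0 := sub_ne_zero.2 (fun e => hmk (hx e))
      simp only [hmk, hnm, hnk, if_false, hg]
      field_simp
      ring
  set T : ι → ℂ := fun n => ∑ m, ((w m * g n m : ℝ) : ℂ) * u m with hT
  have hT' : ∀ n, (w n : ℂ) * T n = c * u n := by
    intro n
    rw [← h n, hT, Finset.mul_sum]
    refine Finset.sum_congr rfl fun m _ => ?_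
    simp only [hg]
    push_cast
    ring
  have hTc : ∀ n, (w n : ℂ) * conj (T n) = - c * conj (u n) := by
    intro n
    have := congrArg conj (hT' n)
    simpa [hc] using this
  set P : ι → ℝ := fun m => ∑ n, w n ^ 2 * g n m with hP
  -- expansion of `∑ wₙ² |Tₙ|²`
  have hexp : ∑ n, ((w n : ℂ) * T n) * ((w n : ℂ) * conj (T n)) =
      ∑ m, ∑ k, ∑ n, ((w n ^ 2 * w m * w k * (g n m * g n k) : ℝ) : ℂ) * (u m * conj (u k)) := by
    have : ∀ n, ((w n : ℂ) * T n) * ((w n : ℂ) * conj (T n)) =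
        ∑ m, ∑ k, ((w n ^ 2 * w m * w k * (g n m * g n k) : ℝ) : ℂ) * (u m * conj (u k)) := by
      intro n
      simp only [hT, map_sum, map_mul, Complex.conj_ofReal]
      rw [mul_mul_mul_comm, Finset.sum_mul_sum, Finset.mul_sum]
      refine Finset.sum_congr rfl fun m _ => ?_
      rw [Finset.mul_sum]
      refine Finset.sum_congr rfl fun k _ => ?_
      push_cast
      ring
    rw [Finset.sum_congr rfl fun n _ => this n, Finset.sum_comm]
    refine Finset.sum_congr rfl fun m _ => ?_
    rw [Finset.sum_comm]
  have hinner : ∀ m k, ∑ n, w n ^ 2 * w m * w k * (g n m * g n k) =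
      (if m = k then w m ^ 2 * ∑ n, w n ^ 2 * g n m ^ 2 else 0)
      + w m * w k * g m k * (P m - P k)
      + (w m ^ 2 + w k ^ 2) * w m * w k * g m k ^ 2 := by
    intro m k
    simp only [hgid]
    simp only [mul_add, Finset.sum_add_distrib]
    congr 1
    · congr 1
      · by_cases hmk : m = k
        · subst hmk
          simp only [if_true, Finset.mul_sum]
          exact Finset.sum_congr rfl fun n _ => by ring
        · simp [hmk]
      · simp only [hP]
        rw [← Finset.sum_sub_distrib, Finset.mul_sum]
        exact Finset.sum_congr rfl fun n _ => by ring
    · simp only [mul_ite, mul_zero, Finset.sum_ite_eq', Finset.mem_univ, if_true]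
      ring
  have hmid : ∑ m, ∑ k, ((w m * w k * g m k * (P m - P k) : ℝ) : ℂ) * (u m * conj (u k)) = 0 := by
    have h1 : ∑ m, ∑ k, ((w m * w k * g m k * P m : ℝ) : ℂ) * (u m * conj (u k)) =
        ∑ m, (P m : ℂ) * u m * ((w m : ℂ) * conj (T m)) := by
      refine Finset.sum_congr rfl fun m _ => ?_
      simp only [hT, map_sum, map_mul, Complex.conj_ofReal, Finset.mul_sum]
      refine Finset.sum_congr rfl fun k _ => ?_
      push_cast
      ring
    have h2 : ∑ m, ∑ k, ((w m * w k * g m k * P k : ℝ) : ℂ) * (u m * conj (u k)) =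
        - ∑ k, (P k : ℂ) * conj (u k) * ((w k : ℂ) * T k) := by
      rw [Finset.sum_comm, ← Finset.sum_neg_distrib]
      refine Finset.sum_congr rfl fun k _ => ?_
      simp only [hT, Finset.mul_sum]
      rw [← Finset.sum_neg_distrib]
      refine Finset.sum_congr rfl fun m _ => ?_
      rw [hganti m k]
      push_cast
      ring
    have h3 : ∑ m, ∑ k, ((w m * w k * g m k * (P m - P k) : ℝ) : ℂ) * (u m * conj (u k)) =
        ∑ m, ∑ k, ((w m * w k * g m k * P m : ℝ) : ℂ) * (u m * conj (u k))
        - ∑ m, ∑ k, ((w m * w k * g m k * P k : ℝ) : ℂ) * (u m * conj (u k)) := by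
      simp only [← Finset.sum_sub_distrib]
      refine Finset.sum_congr rfl fun m _ => Finset.sum_congr rfl fun k _ => ?_
      push_cast
      ring
    rw [h3, h1, h2, sub_neg_eq_add, ← Finset.sum_add_distrib]
    refine Finset.sum_eq_zero fun m _ => ?_
    rw [hT', hTc]
    ring
  set S : ℂ := ∑ m, ∑ k, (((w m ^ 2 + w k ^ 2) * w m * w k * g m k ^ 2 : ℝ) : ℂ)
    * (u m * conj (u k)) with hS
  have hmain : ((Complex.normSq c * ∑ n, ‖u n‖ ^ 2 : ℝ) : ℂ) =
      ((∑ m, (w m ^ 2 * ∑ n, w n ^ 2 * g n m ^ 2) * ‖u m‖ ^ 2 : ℝ) : ℂ) + S := by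
    have h1 : ((Complex.normSq c * ∑ n, ‖u n‖ ^ 2 : ℝ) : ℂ) =
        ∑ n, ((w n : ℂ) * T n) * ((w n : ℂ) * conj (T n)) := by
      push_cast
      rw [Finset.mul_sum]
      refine Finset.sum_congr rfl fun n _ => ?_
      rw [hT', hTc, ← Complex.mul_conj, hc, ← Complex.mul_conj']
      ring
    rw [h1, hexp]
    have h2 : ∀ m k, ∑ n, ((w n ^ 2 * w m * w k * (g n m * g n k) : ℝ) : ℂ) * (u m * conj (u k)) =
        (if m = k then (((w m ^ 2 * ∑ n, w n ^ 2 * g n m ^ 2) * ‖u m‖ ^ 2 : ℝ) : ℂ) else 0)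
        + ((w m * w k * g m k * (P m - P k) : ℝ) : ℂ) * (u m * conj (u k))
        + (((w m ^ 2 + w k ^ 2) * w m * w k * g m k ^ 2 : ℝ) : ℂ) * (u m * conj (u k)) := by
      intro m k
      rw [← Finset.sum_mul, ← Complex.ofReal_sum, hinner m k, Complex.ofReal_add,
        Complex.ofReal_add, add_mul, add_mul]
      congr 2
      by_cases hmk : m = k
      · subst hmk
        simp only [if_true]
        rw [Complex.mul_conj', Complex.ofReal_mul _ (‖u m‖ ^ 2), Complex.ofReal_pow ‖u m‖]
      · simp [hmk]
    simp only [h2, Finset.sum_add_distrib]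
    rw [hmid, add_zero, hS]
    congr 1
    simp
  have hSn : ‖S‖ ≤ ∑ m, (∑ k, w k ^ 2 * (w m ^ 2 + w k ^ 2) * g m k ^ 2) * ‖u m‖ ^ 2 := by
    have hterm : ∀ m k, ‖(((w m ^ 2 + w k ^ 2) * w m * w k * g m k ^ 2 : ℝ) : ℂ)
        * (u m * conj (u k))‖ ≤
        (w m ^ 2 + w k ^ 2) * g m k ^ 2 * (w k ^ 2 * ‖u m‖ ^ 2) / 2
        + (w m ^ 2 + w k ^ 2) * g m k ^ 2 * (w m ^ 2 * ‖u k‖ ^ 2) / 2 := by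
      intro m k
      have := hw m
      have := hw k
      rw [norm_mul, norm_mul, RCLike.norm_conj, Complex.norm_real, Real.norm_of_nonneg
        (by positivity)]
      have h0 : 0 ≤ (w m ^ 2 + w k ^ 2) * g m k ^ 2 := by positivity
      nlinarith [mul_nonneg h0 (sq_nonneg (w k * ‖u m‖ - w m * ‖u k‖))]
    have h1 : ‖S‖ ≤ ∑ m, ∑ k, ((w m ^ 2 + w k ^ 2) * g m k ^ 2 * (w k ^ 2 * ‖u m‖ ^ 2) / 2
        + (w m ^ 2 + w k ^ 2) * g m k ^ 2 * (w m ^ 2 * ‖u k‖ ^ 2) / 2) := by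
      refine (norm_sum_le _ _).trans (Finset.sum_le_sum fun m _ => ?_)
      exact (norm_sum_le _ _).trans (Finset.sum_le_sum fun k _ => hterm m k)
    refine h1.trans (le_of_eq ?_)
    simp only [Finset.sum_add_distrib]
    rw [Finset.sum_comm (f := fun m k => (w m ^ 2 + w k ^ 2) * g m k ^ 2 * (w m ^ 2 * ‖u k‖ ^ 2) / 2),
      ← Finset.sum_add_distrib]
    refine Finset.sum_congr rfl fun m _ => ?_
    rw [← Finset.sum_add_distrib, Finset.sum_mul]
    refine Finset.sum_congr rfl fun k _ => ?_
    rw [hganti k m]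
    ring
  have hfin : Complex.normSq c * ∑ n, ‖u n‖ ^ 2 ≤ B * ∑ n, ‖u n‖ ^ 2 := by
    have h1 : Complex.normSq c * ∑ n, ‖u n‖ ^ 2 =
        ∑ m, (w m ^ 2 * ∑ n, w n ^ 2 * g n m ^ 2) * ‖u m‖ ^ 2 + S.re := by
      have := congrArg Complex.re hmain
      simpa only [Complex.add_re, Complex.ofReal_re] using this
    have h2 : ∀ m, w m ^ 2 * ∑ n, w n ^ 2 * g n m ^ 2 +
        ∑ k, w k ^ 2 * (w m ^ 2 + w k ^ 2) * g m k ^ 2 ≤ B := by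
      intro m
      refine le_trans (le_of_eq ?_) (hB m)
      rw [Finset.mul_sum, ← Finset.sum_add_distrib]
      refine Finset.sum_congr rfl fun k _ => ?_
      rw [hganti k m]
      simp only [hg]
      ring
    rw [h1]
    have h3 := (Complex.re_le_norm S).trans hSn
    calc _ ≤ ∑ m, (w m ^ 2 * ∑ n, w n ^ 2 * g n m ^ 2) * ‖u m‖ ^ 2
        + ∑ m, (∑ k, w k ^ 2 * (w m ^ 2 + w k ^ 2) * g m k ^ 2) * ‖u m‖ ^ 2 := by linarith
      _ ≤ _ := by
        rw [← Finset.sum_add_distrib, Finset.mul_sum]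
        refine Finset.sum_le_sum fun m _ => ?_
        rw [← add_mul]
        exact mul_le_mul_of_nonneg_right (h2 m) (by positivity)
  obtain ⟨i, hi⟩ := Function.ne_iff.1 hu
  have hpos : 0 < ∑ n, ‖u n‖ ^ 2 :=
    Finset.sum_pos' (fun n _ => by positivity) ⟨i, Finset.mem_univ i, by
      have : 0 < ‖u i‖ := norm_pos_iff.2 hi
      positivity⟩
  exact le_of_mul_le_mul_right hfin hpos

open Finset ComplexConjugate ComplexOrder in
/-- Quadratic form bound for the generalized Hilbert matrix. -/
lemma re_hilbert_form_le {ι : Type*} [Fintype ι] (x w : ι → ℝ)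
    (hx : Function.Injective x) (hw : ∀ i, 0 < w i) {B : ℝ} (hB0 : 0 ≤ B)
    (hB : ∀ m, ∑ k, w k ^ 2 * (2 * w m ^ 2 + w k ^ 2) * ((x m - x k)⁻¹) ^ 2 ≤ B ^ 2)
    (u : ι → ℂ) :
    (∑ n, ∑ m, conj (u n) * ((w n * w m * (x n - x m)⁻¹ : ℝ) * Complex.I) * u m).re
      ≤ B * ∑ n, ‖u n‖ ^ 2 := by
  classical
  set H : Matrix ι ι ℂ := Matrix.of fun n m => ((w n * w m * (x n - x m)⁻¹ : ℝ) : ℂ) * Complex.I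
    with hH
  set M : Matrix ι ι ℂ := (B : ℂ) • (1 : Matrix ι ι ℂ) - H with hM
  have hMv : ∀ v : ι → ℂ, ∀ n, M.mulVec v n = B * v n -
      ∑ m, ((w n * w m * (x n - x m)⁻¹ : ℝ) : ℂ) * Complex.I * v m := by
    intro v n
    simp only [hM, hH, Matrix.sub_mulVec, Matrix.smul_mulVec, Matrix.one_mulVec, Pi.sub_apply,
      Pi.smul_apply, smul_eq_mul]
    rfl
  have hHerm : M.IsHermitian := by
    ext n m
    simp only [hM, hH, Matrix.conjTranspose_apply, Matrix.sub_apply, Matrix.smul_apply,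
      Matrix.of_apply, smul_eq_mul, star_sub, star_mul', Matrix.one_apply, eq_comm (a := m)]
    have : (x m - x n)⁻¹ = -(x n - x m)⁻¹ := by rw [← neg_sub, inv_neg]
    rw [this]
    split_ifs <;> simp [mul_comm (w m : ℂ)]
  have hps : M.PosSemidef := by
    rw [hHerm.posSemidef_iff_eigenvalues_nonneg]
    intro j
    have hev := hHerm.mulVec_eigenvectorBasis j
    set ν := hHerm.eigenvalues j
    set v : ι → ℂ := (hHerm.eigenvectorBasis j).ofLp with hv
    have hv0 : v ≠ 0 := by
      intro h0
      refine hHerm.eigenvectorBasis.toBasis.ne_zero j ?_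
      rw [OrthonormalBasis.coe_toBasis]
      ext i
      exact congrFun h0 i
    have hn := normSq_eigenvalue_le x w hx hw hB v hv0 (-((B - ν : ℝ) : ℂ) * Complex.I)
      (by simp) (by
        intro n
        have h1 := congrFun hev n
        rw [hMv] at h1
        simp only [Pi.smul_apply, Complex.real_smul] at h1
        have h2 : Complex.I * ∑ m, ((w n * w m * (x n - x m)⁻¹ : ℝ) : ℂ) * v m =
            ((B - ν : ℝ) : ℂ) * v n := by
          rw [Finset.mul_sum]
          have : ∑ m, Complex.I * (((w n * w m * (x n - x m)⁻¹ : ℝ) : ℂ) * v m) =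
              ∑ m, ((w n * w m * (x n - x m)⁻¹ : ℝ) : ℂ) * Complex.I * v m :=
            Finset.sum_congr rfl fun m _ => by ring
          rw [this, Complex.ofReal_sub]
          linear_combination -h1
        linear_combination (-Complex.I) * h2 +
          (∑ m, ((w n * w m * (x n - x m)⁻¹ : ℝ) : ℂ) * v m) * (Complex.I_mul_I))
    rw [Complex.normSq_mul, Complex.normSq_neg, Complex.normSq_ofReal, Complex.normSq_I,
      mul_one, ← sq] at hn
    have := abs_le_of_sq_le_sq' hn hB0
    show 0 ≤ ν
    linarith [this.2]
  have h := hps.re_dotProduct_nonneg u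
  have h1 : star u ⬝ᵥ M.mulVec u = ((B * ∑ n, ‖u n‖ ^ 2 : ℝ) : ℂ) -
      ∑ n, ∑ m, conj (u n) * ((w n * w m * (x n - x m)⁻¹ : ℝ) * Complex.I) * u m := by
    rw [dotProduct]
    push_cast
    rw [Finset.mul_sum, ← Finset.sum_sub_distrib]
    refine Finset.sum_congr rfl fun n _ => ?_
    rw [hMv, ← Complex.mul_conj', mul_sub, Finset.mul_sum]
    congr 1
    · simp; ring
    · refine Finset.sum_congr rfl fun m _ => ?_
      simp
      ring
  rw [h1] at h
  simp only [RCLike.re_to_complex, Complex.sub_re, Complex.ofReal_re] at h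
  linarith

open Finset ComplexConjugate in
/-- Mean square of a generalized Dirichlet polynomial. -/
lemma integral_norm_sq_sum_le {ι : Type*} [Fintype ι] (x w : ι → ℝ)
    (hx : Function.Injective x) (hw : ∀ i, 0 < w i) {B : ℝ} (hB0 : 0 ≤ B)
    (hB : ∀ m, ∑ k, w k ^ 2 * (2 * w m ^ 2 + w k ^ 2) * ((x m - x k)⁻¹) ^ 2 ≤ B ^ 2)
    (a : ι → ℂ) (D : ℝ) :
    ∫ t in (0 : ℝ)..D, ‖∑ n, a n * w n * Complex.exp (-(x n * t * Complex.I))‖ ^ 2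
      ≤ D * ∑ n, w n ^ 2 * ‖a n‖ ^ 2 + 2 * B * ∑ n, ‖a n‖ ^ 2 := by
  classical
  set A : ℝ → ι → ℂ := fun t n => a n * Complex.exp (-(x n * t * Complex.I)) with hA
  have hAn : ∀ t n, ‖A t n‖ = ‖a n‖ := by
    intro t n
    have : -(x n * t * Complex.I : ℂ) = ((-(x n * t) : ℝ) : ℂ) * Complex.I := by push_cast; ring
    simp only [hA]
    rw [norm_mul, this, Complex.norm_exp_ofReal_mul_I, mul_one]
  set q : ℝ → ℂ := fun t =>
    ∑ n, ∑ m, conj (A t n) * ((w n * w m * (x n - x m)⁻¹ : ℝ) * Complex.I) * A t m with hq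
  have hAd : ∀ t n, HasDerivAt (fun t => A t n) (-(x n * Complex.I) * A t n) t := by
    intro t n
    have h1 : HasDerivAt (fun t : ℝ => -(x n * (t : ℂ) * Complex.I)) (-(x n * 1 * Complex.I)) t :=
      (((Complex.ofRealCLM.hasDerivAt (x := t)).const_mul (x n : ℂ)).mul_const Complex.I).neg
    refine ((h1.cexp).const_mul (a n)).congr_deriv ?_
    simp only [hA]
    ring
  have hAcd : ∀ t n, HasDerivAt (fun t => conj (A t n)) ((x n * Complex.I) * conj (A t n)) t := by
    intro t n
    refine (hAd t n).star.congr_deriv ?_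
    simp
  have hqd : ∀ t : ℝ, HasDerivAt q (((∑ n, w n ^ 2 * ‖a n‖ ^ 2 : ℝ) : ℂ) -
      ((‖∑ n, a n * w n * Complex.exp (-(x n * t * Complex.I))‖ ^ 2 : ℝ) : ℂ)) t := by
    intro t
    have h1 : HasDerivAt q (∑ n, ∑ m,
        ((x n * Complex.I) * conj (A t n) * ((w n * w m * (x n - x m)⁻¹ : ℝ) * Complex.I) * A t m
        + conj (A t n) * ((w n * w m * (x n - x m)⁻¹ : ℝ) * Complex.I)
          * (-(x m * Complex.I) * A t m))) t := by
      refine HasDerivAt.fun_sum fun n _ => HasDerivAt.fun_sum fun m _ => ?_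
      exact ((hAcd t n).mul_const _).mul (hAd t m)
    convert h1 using 1
    have h2 : ((‖∑ n, a n * w n * Complex.exp (-(x n * t * Complex.I))‖ ^ 2 : ℝ) : ℂ) =
        ∑ n, ∑ m, conj (A t n) * (w n * w m) * A t m := by
      rw [Complex.ofReal_pow, ← Complex.conj_mul', map_sum, Finset.sum_mul_sum]
      refine Finset.sum_congr rfl fun n _ => Finset.sum_congr rfl fun m _ => ?_
      simp only [hA, map_mul, Complex.conj_ofReal]
      ring
    have h3 : ((∑ n, w n ^ 2 * ‖a n‖ ^ 2 : ℝ) : ℂ) =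
        ∑ n, ∑ m, if n = m then conj (A t n) * (w n * w m) * A t m else 0 := by
      rw [Complex.ofReal_sum]
      refine Finset.sum_congr rfl fun n _ => ?_
      rw [Finset.sum_ite_eq, if_pos (Finset.mem_univ n), ← hAn t n]
      push_cast
      rw [← Complex.conj_mul']
      ring
    rw [h2, h3, ← Finset.sum_sub_distrib]
    refine Finset.sum_congr rfl fun n _ => ?_
    rw [← Finset.sum_sub_distrib]
    refine Finset.sum_congr rfl fun m _ => ?_
    by_cases hnm : n = m
    · subst hnm
      simp
    · have hne : (x n : ℂ) - x m ≠ 0 := by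
        rw [← Complex.ofReal_sub]
        exact Complex.ofReal_ne_zero.2 (sub_ne_zero.2 fun e => hnm (hx e))
      rw [if_neg hnm]
      push_cast
      field_simp
      rw [Complex.I_sq]
      ring
  have hcont : Continuous fun t : ℝ =>
      ‖∑ n, a n * w n * Complex.exp (-(x n * t * Complex.I))‖ ^ 2 := by fun_prop
  have hcontC : Continuous fun t : ℝ =>
      ((‖∑ n, a n * w n * Complex.exp (-(x n * t * Complex.I))‖ ^ 2 : ℝ) : ℂ) :=
    Complex.continuous_ofReal.comp hcont
  have hftc := intervalIntegral.integral_eq_sub_of_hasDerivAt (a := 0) (b := D)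
    (fun t _ => hqd t)
    ((continuous_const.sub hcontC).intervalIntegrable _ _)
  rw [intervalIntegral.integral_sub (by simp)
    (hcontC.intervalIntegrable _ _), intervalIntegral.integral_const,
    intervalIntegral.integral_ofReal] at hftc
  have hre := congrArg Complex.re hftc
  simp only [Complex.sub_re, Complex.ofReal_re, sub_zero, Complex.real_smul,
    Complex.re_ofReal_mul] at hre
  have hb1 : (q 0).re ≤ B * ∑ n, ‖a n‖ ^ 2 := by
    have := re_hilbert_form_le x w hx hw hB0 hB (A 0)
    simpa only [hAn] using this
  have hb2 : -(q D).re ≤ B * ∑ n, ‖a n‖ ^ 2 := by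
    have h1 := re_hilbert_form_le (fun n => - x n) w (fun i j h => hx (neg_injective h)) hw hB0
      (fun m => by
        refine le_trans (le_of_eq ?_) (hB m)
        refine Finset.sum_congr rfl fun k _ => ?_
        rw [neg_sub_neg, ← neg_sub, inv_neg, neg_sq]) (A D)
    simp only [hAn] at h1
    refine le_trans (le_of_eq ?_) h1
    rw [← Complex.neg_re]
    congr 1
    simp only [hq, ← Finset.sum_neg_distrib]
    refine Finset.sum_congr rfl fun n _ => Finset.sum_congr rfl fun m _ => ?_
    rw [neg_sub_neg, ← neg_sub (x n) (x m), inv_neg]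
    push_cast
    ring
  linarith

lemma sum_inv_sq_le (n : ℕ) : ∑ k ∈ Finset.range n, (((k : ℝ) + 1) ^ 2)⁻¹ ≤ 2 := by
  suffices h : ∑ k ∈ Finset.range (n + 1), (((k : ℝ) + 1) ^ 2)⁻¹ ≤ 2 - ((n : ℝ) + 1)⁻¹ by
    rw [Finset.sum_range_succ] at h
    have : (0 : ℝ) ≤ (((n : ℝ) + 1) ^ 2)⁻¹ := by positivity
    have : (0 : ℝ) ≤ ((n : ℝ) + 1)⁻¹ := by positivity
    linarith
  induction n with
  | zero => norm_num
  | succ n ih =>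
    rw [Finset.sum_range_succ]
    have : (((n + 1 : ℕ) : ℝ) + 1) ^ 2 = ((n : ℝ) + 2) ^ 2 := by push_cast; ring
    rw [this]
    have h : (((n : ℝ) + 2) ^ 2)⁻¹ ≤ ((n : ℝ) + 1)⁻¹ - ((n : ℝ) + 2)⁻¹ := by
      rw [inv_sub_inv (by positivity) (by positivity), inv_eq_one_div]
      apply div_le_div₀ <;> first | positivity | nlinarith
    push_cast
    have e : (n : ℝ) + 1 + 1 = n + 2 := by ring
    rw [e]
    linarith

/-- Terms of the row sum to the left of the diagonal. -/
lemma row_term_left_le {x y : ℝ} (hy : 1 ≤ y) (hxy : y + 1 ≤ x) :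
    y⁻¹ * (2 * x⁻¹ + y⁻¹) * ((Real.log x - Real.log y)⁻¹) ^ 2 ≤
      3 * ((x - y) ^ 2)⁻¹ + 3 / 4 * x⁻¹ + (x - 1)⁻¹ + 1 / 4 * (y ^ 2)⁻¹ := by
  have hx0 : 0 < x := by linarith
  have hy0 : 0 < y := by linarith
  have hd : 0 < x - y := by linarith
  have hlog : 2 * (x - y) / (x + y) ≤ Real.log x - Real.log y := by
    have h := Real.le_log_one_add_of_nonneg (x := (x - y) / y) (by positivity)
    have e1 : 1 + (x - y) / y = x / y := by field_simp; ring
    rw [e1, Real.log_div hx0.ne' hy0.ne'] at h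
    refine le_trans (le_of_eq ?_) h
    field_simp
    ring
  have hpos : 0 < 2 * (x - y) / (x + y) := by positivity
  have h1 : ((Real.log x - Real.log y)⁻¹) ^ 2 ≤ ((2 * (x - y) / (x + y))⁻¹) ^ 2 :=
    pow_le_pow_left₀ (inv_nonneg.2 (hpos.le.trans hlog)) (inv_anti₀ hpos hlog) 2
  have h2 : y⁻¹ * (2 * x⁻¹ + y⁻¹) * ((2 * (x - y) / (x + y))⁻¹) ^ 2 =
      3 * ((x - y) ^ 2)⁻¹ + 3 / 4 * (x * y)⁻¹ + ((x - y) * y)⁻¹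
        + 1 / 4 * ((x - y) / x) * (y ^ 2)⁻¹ := by
    field_simp
    ring
  have h3 : (x * y)⁻¹ ≤ x⁻¹ := inv_anti₀ hx0 (by nlinarith)
  have h4 : ((x - y) * y)⁻¹ ≤ (x - 1)⁻¹ := inv_anti₀ (by linarith) (by nlinarith)
  have h5 : 1 / 4 * ((x - y) / x) * (y ^ 2)⁻¹ ≤ 1 / 4 * (y ^ 2)⁻¹ := by
    have : (x - y) / x ≤ 1 := by rw [div_le_one hx0]; linarith
    have : 1 / 4 * ((x - y) / x) ≤ 1 / 4 := by linarith
    gcongr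
  calc _ ≤ y⁻¹ * (2 * x⁻¹ + y⁻¹) * ((2 * (x - y) / (x + y))⁻¹) ^ 2 := by gcongr
    _ ≤ _ := by rw [h2]; linarith

/-- Partial sums of the row to the right of the diagonal, by telescoping. -/
lemma sum_inv_mul_log_sq_le {x : ℝ} (hx : 1 ≤ x) (y : ℕ → ℝ) (hy0 : x + 1 ≤ y 0)
    (hy : ∀ n, y n + 1 ≤ y (n + 1)) (n : ℕ) :
    ∑ j ∈ Finset.range n, (y j)⁻¹ * ((Real.log (y j) - Real.log x)⁻¹) ^ 2 ≤ 2 * (x + 1) := by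
  have hyx : ∀ n, x + 1 ≤ y n := by
    intro n
    induction n with
    | zero => exact hy0
    | succ n ih => linarith [hy n]
  have hlog : ∀ {a b : ℝ}, 0 < a → 0 < b → (b - a) / b ≤ Real.log b - Real.log a := by
    intro a b ha hb
    have h := Real.one_sub_inv_le_log_of_pos (div_pos hb ha)
    rw [Real.log_div hb.ne' ha.ne'] at h
    refine le_trans (le_of_eq ?_) h
    field_simp
  have hl0 : ∀ n, 0 < Real.log (y n) - Real.log x := fun n => by
    have := hyx n
    exact sub_pos.2 (Real.log_lt_log (by linarith) (by linarith))
  suffices h : ∑ j ∈ Finset.range (n + 1), (y j)⁻¹ * ((Real.log (y j) - Real.log x)⁻¹) ^ 2 ≤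
      2 * (x + 1) - (Real.log (y n) - Real.log x)⁻¹ by
    rw [Finset.sum_range_succ] at h
    have := hl0 n
    have := hyx n
    have : 0 < y n := by linarith
    have : 0 ≤ (y n)⁻¹ * ((Real.log (y n) - Real.log x)⁻¹) ^ 2 := by positivity
    have : 0 ≤ (Real.log (y n) - Real.log x)⁻¹ := by positivity
    linarith
  induction n with
  | zero =>
    have hb := hyx 0
    have hb0 : 0 < y 0 := by linarith
    have hd : 0 < (y 0 - x) / y 0 := div_pos (by linarith) hb0
    have h1 : (Real.log (y 0) - Real.log x)⁻¹ ≤ ((y 0 - x) / y 0)⁻¹ :=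
      inv_anti₀ hd (hlog (by linarith) hb0)
    have hp := inv_pos.2 (hl0 0)
    have h2 : ((y 0 - x) / y 0)⁻¹ ≤ x + 1 := by
      rw [inv_div, div_le_iff₀ (by linarith)]; nlinarith
    have h3 : (y 0)⁻¹ * (((y 0 - x) / y 0)⁻¹) ^ 2 ≤ x + 1 := by
      have : (y 0)⁻¹ * (((y 0 - x) / y 0)⁻¹) ^ 2 = y 0 / (y 0 - x) ^ 2 := by
        have : y 0 - x ≠ 0 := by linarith
        field_simp
      rw [this, div_le_iff₀ (by nlinarith)]
      nlinarith [mul_nonneg (by linarith : (0:ℝ) ≤ x + 1) (mul_nonneg (by linarith : 0 ≤ y 0 - x) (by linarith : 0 ≤ y 0 - x - 1))]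
    have h4 : (y 0)⁻¹ * ((Real.log (y 0) - Real.log x)⁻¹) ^ 2 ≤
        (y 0)⁻¹ * (((y 0 - x) / y 0)⁻¹) ^ 2 := by gcongr
    simp only [zero_add, Finset.sum_range_one]
    linarith
  | succ n ih =>
    rw [Finset.sum_range_succ]
    have ha := hl0 n
    have hb := hl0 (n + 1)
    have hya := hyx n
    have hyb := hyx (n + 1)
    have hyb0 : 0 < y (n + 1) := by linarith
    have h1 : (y (n + 1))⁻¹ ≤ Real.log (y (n + 1)) - Real.log (y n) := by
      refine le_trans ?_ (hlog (by linarith) hyb0)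
      rw [inv_eq_one_div]
      have := hy n
      gcongr
      linarith
    have hab : Real.log (y n) - Real.log x ≤ Real.log (y (n + 1)) - Real.log x := by
      have : 0 < (y (n + 1))⁻¹ := by positivity
      linarith
    have h2 : (y (n + 1))⁻¹ * ((Real.log (y (n + 1)) - Real.log x)⁻¹) ^ 2 ≤
        (Real.log (y n) - Real.log x)⁻¹ - (Real.log (y (n + 1)) - Real.log x)⁻¹ := by
      rw [inv_sub_inv ha.ne' hb.ne', inv_pow, ← div_eq_mul_inv]
      apply div_le_div₀
      · linarith
      · linarith
      · positivity
      · nlinarith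
    linarith

lemma row_sum_le (X : ℕ → ℝ) (hX0 : 1 ≤ X 0) (hX : ∀ n, X n + 1 ≤ X (n + 1)) (N m : ℕ) :
    ∑ k ∈ Finset.range N,
      (X k)⁻¹ * (2 * (X m)⁻¹ + (X k)⁻¹) * ((Real.log (X m) - Real.log (X k))⁻¹) ^ 2 ≤ 22 := by
  have hgap : ∀ k j : ℕ, X k + j ≤ X (k + j) := by
    intro k j
    induction j with
    | zero => simp
    | succ j ih => have := hX (k + j); rw [← add_assoc]; push_cast; linarith
  have hge : ∀ k : ℕ, (k : ℝ) + 1 ≤ X k := by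
    intro k
    have := hgap 0 k
    rw [zero_add] at this
    linarith
  have hpos : ∀ k, 0 < X k := fun k => by
    have := hge k
    have : (0 : ℝ) ≤ k := by positivity
    linarith
  have hxm : 1 ≤ X m := by
    have := hge m
    have : (0 : ℝ) ≤ m := by positivity
    linarith
  set f : ℕ → ℝ := fun k =>
    (X k)⁻¹ * (2 * (X m)⁻¹ + (X k)⁻¹) * ((Real.log (X m) - Real.log (X k))⁻¹) ^ 2 with hf
  have hf0 : ∀ k, 0 ≤ f k := fun k => by
    have := hpos k
    have := hpos m
    positivity
  have hfm : f m = 0 := by simp [hf]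
  have hleft : ∑ k ∈ Finset.range m, f k ≤ 9 := by
    have h1 : ∀ k ∈ Finset.range m, f k ≤ 3 * ((((m - 1 - k : ℕ) : ℝ) + 1) ^ 2)⁻¹
        + (3 / 4 * (X m)⁻¹ + (X m - 1)⁻¹) + 1 / 4 * (((k : ℝ) + 1) ^ 2)⁻¹ := by
      intro k hk
      have hkm := Finset.mem_range.1 hk
      have hj : (((m - 1 - k : ℕ) : ℝ) + 1) ≤ X m - X k := by
        have := hgap k (m - k)
        rw [Nat.add_sub_cancel' hkm.le] at this
        have e : m - k = m - 1 - k + 1 := by omega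
        rw [e] at this
        push_cast at this
        linarith
      have hj1 : (0 : ℝ) ≤ ((m - 1 - k : ℕ) : ℝ) := by positivity
      have hk0 : (0 : ℝ) ≤ k := by positivity
      have hk1 := hge k
      have h := row_term_left_le (x := X m) (y := X k) (by linarith) (by linarith)
      have h2 : ((X m - X k) ^ 2)⁻¹ ≤ ((((m - 1 - k : ℕ) : ℝ) + 1) ^ 2)⁻¹ := by gcongr
      have h3 : ((X k) ^ 2)⁻¹ ≤ (((k : ℝ) + 1) ^ 2)⁻¹ := by gcongr
      linarith
    refine (Finset.sum_le_sum h1).trans ?_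
    rw [Finset.sum_add_distrib, Finset.sum_add_distrib, ← Finset.mul_sum, ← Finset.mul_sum,
      Finset.sum_range_reflect (fun k : ℕ => (((k : ℝ) + 1) ^ 2)⁻¹) m, Finset.sum_const,
      Finset.card_range, nsmul_eq_mul]
    have hs := sum_inv_sq_le m
    have hm := hge m
    have h2 : (m : ℝ) * (X m)⁻¹ ≤ 1 := by
      rw [← div_eq_mul_inv, div_le_one (by linarith)]; linarith
    have h3 : (m : ℝ) * (X m - 1)⁻¹ ≤ 1 := by
      rw [← div_eq_mul_inv]
      exact div_le_one_of_le₀ (by linarith) (by linarith)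
    rw [mul_add]
    linarith
  have hright : ∀ J, ∑ j ∈ Finset.range J, f (m + 1 + j) ≤ 12 := by
    intro J
    have h1 : ∀ j ∈ Finset.range J, f (m + 1 + j) ≤ 3 * (X m)⁻¹ *
        ((X (m + 1 + j))⁻¹ * ((Real.log (X (m + 1 + j)) - Real.log (X m))⁻¹) ^ 2) := by
      intro j _
      have hle : X m ≤ X (m + 1 + j) := by
        have := hgap m (1 + j)
        rw [← add_assoc] at this
        have h0 : (0 : ℝ) ≤ ((1 + j : ℕ) : ℝ) := by positivity
        linarith
      have hi : (X (m + 1 + j))⁻¹ ≤ (X m)⁻¹ := inv_anti₀ (hpos m) hle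
      have hsq : ((Real.log (X m) - Real.log (X (m + 1 + j)))⁻¹) ^ 2 =
          ((Real.log (X (m + 1 + j)) - Real.log (X m))⁻¹) ^ 2 := by
        rw [← neg_sub, inv_neg, neg_sq]
      simp only [hf]
      rw [hsq]
      have hp := hpos (m + 1 + j)
      calc _ ≤ (X (m + 1 + j))⁻¹ * (3 * (X m)⁻¹) *
            ((Real.log (X (m + 1 + j)) - Real.log (X m))⁻¹) ^ 2 := by gcongr; linarith
        _ = _ := by ring
    refine (Finset.sum_le_sum h1).trans ?_
    rw [← Finset.mul_sum]
    have h2 := sum_inv_mul_log_sq_le hxm (fun j => X (m + 1 + j)) (hX m) (fun j => hX (m + 1 + j)) J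
    have hp := hpos m
    calc _ ≤ 3 * (X m)⁻¹ * (2 * (X m + 1)) := by gcongr
      _ = 6 + 6 * (X m)⁻¹ := by field_simp; norm_num
      _ ≤ 12 := by
        have := inv_le_one_of_one_le₀ hxm
        linarith
  calc ∑ k ∈ Finset.range N, f k ≤ ∑ k ∈ Finset.range (m + 1 + N), f k :=
        Finset.sum_le_sum_of_subset_of_nonneg (Finset.range_mono (by omega)) (fun k _ _ => hf0 k)
    _ ≤ 22 := by
      rw [Finset.sum_range_add, Finset.sum_range_succ, hfm]
      linarith [hright N]

/-- In the coordinate `X = C e^{2σλ} / (2σ)` the frequencies are `1`-separated. -/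
lemma exp_add_one_le_of_separated {C σ x y : ℝ} (hσ : 0 < σ) (hC : 0 < C) (hxy : x < y)
    (h : Real.exp (-σ * (x + y)) ≤ C * (y - x)) :
    C * Real.exp (2 * σ * x) / (2 * σ) + 1 ≤ C * Real.exp (2 * σ * y) / (2 * σ) := by
  have h1 : 2 * (σ * (y - x)) ≤ Real.exp (σ * (y - x)) - Real.exp (-(σ * (y - x))) := by
    have := Real.self_le_sinh_iff.2 (mul_nonneg hσ.le (sub_nonneg.2 hxy.le))
    rw [Real.sinh_eq] at this
    linarith
  have h2 : 1 ≤ Real.exp (σ * (x + y)) * (C * (y - x)) := by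
    calc (1 : ℝ) = Real.exp (σ * (x + y)) * Real.exp (-σ * (x + y)) := by
          rw [← Real.exp_add]; simp
      _ ≤ _ := by gcongr
  have h3 : Real.exp (2 * σ * y) - Real.exp (2 * σ * x) =
      Real.exp (σ * (x + y)) * (Real.exp (σ * (y - x)) - Real.exp (-(σ * (y - x)))) := by
    rw [mul_sub, ← Real.exp_add, ← Real.exp_add]
    congr 2 <;> ring
  have h4 : 2 * σ ≤ C * (Real.exp (2 * σ * y) - Real.exp (2 * σ * x)) := by
    rw [h3]
    calc 2 * σ ≤ 2 * σ * (Real.exp (σ * (x + y)) * (C * (y - x))) :=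
          le_mul_of_one_le_right (by positivity) h2
      _ = C * (Real.exp (σ * (x + y)) * (2 * (σ * (y - x)))) := by ring
      _ ≤ _ := by gcongr
  rw [← sub_nonneg]
  have : C * Real.exp (2 * σ * y) / (2 * σ) - (C * Real.exp (2 * σ * x) / (2 * σ) + 1) =
      (C * (Real.exp (2 * σ * y) - Real.exp (2 * σ * x)) - 2 * σ) / (2 * σ) := by
    field_simp
    ring
  rw [this]
  exact div_nonneg (by linarith) (by positivity)

lemma integral_norm_sq_dirichlet_sum_le (lam : ℕ → ℝ) (hmono : StrictMono lam) {C σ : ℝ}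
    (hσ : 0 < σ) (hC : 0 < C)
    (hsep : ∀ n, Real.exp (-σ * (lam n + lam (n + 1))) ≤ C * (lam (n + 1) - lam n))
    (h0 : 2 * σ ≤ C * Real.exp (2 * σ * lam 0)) (a : ℕ → ℂ) (N : ℕ) (D : ℝ) :
    ∫ t in (0 : ℝ)..D, ‖∑ n ∈ Finset.range N,
        a n * Real.exp (-σ * lam n) * Complex.exp (-(lam n * t * Complex.I))‖ ^ 2
      ≤ D * ∑ n ∈ Finset.range N, Real.exp (-σ * lam n) ^ 2 * ‖a n‖ ^ 2
        + 3 * Real.pi * C * ∑ n ∈ Finset.range N, ‖a n‖ ^ 2 := by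
  set X : ℕ → ℝ := fun n => C * Real.exp (2 * σ * lam n) / (2 * σ) with hX
  have hX1 : ∀ n, X n + 1 ≤ X (n + 1) := fun n =>
    exp_add_one_le_of_separated hσ hC (hmono n.lt_succ_self) (hsep n)
  have hX0 : 1 ≤ X 0 := by rw [hX, one_le_div (by positivity)]; exact h0
  have hw : ∀ n, Real.exp (-σ * lam n) ^ 2 = C / (2 * σ) * (X n)⁻¹ := by
    intro n
    have e : Real.exp (2 * σ * lam n) = (Real.exp (-σ * lam n) ^ 2)⁻¹ := by
      rw [← Real.exp_nat_mul, ← Real.exp_neg]; congr 1; push_cast; ring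
    simp only [hX, e]
    field_simp
  have hlog : ∀ m k, lam m - lam k = (Real.log (X m) - Real.log (X k)) / (2 * σ) := by
    intro m k
    have : ∀ n, Real.log (X n) = Real.log (C / (2 * σ)) + 2 * σ * lam n := by
      intro n
      have e : X n = C / (2 * σ) * Real.exp (2 * σ * lam n) := by simp only [hX]; ring
      rw [e, Real.log_mul (by positivity) (Real.exp_pos _).ne', Real.log_exp]
    rw [this, this]
    field_simp
    ring
  have h := integral_norm_sq_sum_le (fun i : Fin N => lam i) (fun i => Real.exp (-σ * lam i))
    (fun i j hij => Fin.ext (hmono.injective hij)) (fun i => Real.exp_pos _)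
    (B := 3 * Real.pi / 2 * C) (by positivity) (fun m => by
      have hr := row_sum_le X hX0 hX1 N m
      have e : ∀ k : ℕ, Real.exp (-σ * lam k) ^ 2 *
          (2 * Real.exp (-σ * lam m) ^ 2 + Real.exp (-σ * lam k) ^ 2) *
            ((lam m - lam k)⁻¹) ^ 2 =
          C ^ 2 * ((X k)⁻¹ * (2 * (X m)⁻¹ + (X k)⁻¹) *
            ((Real.log (X m) - Real.log (X k))⁻¹) ^ 2) := by
        intro k
        rw [hw, hw, hlog, inv_div]
        field_simp
      rw [Fin.sum_univ_eq_sum_range (fun k : ℕ => Real.exp (-σ * lam k) ^ 2 *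
          (2 * Real.exp (-σ * lam m) ^ 2 + Real.exp (-σ * lam k) ^ 2) *
            ((lam m - lam k)⁻¹) ^ 2) N, Finset.sum_congr rfl fun k _ => e k, ← Finset.mul_sum]
      have hpi := Real.pi_gt_d2
      calc _ ≤ C ^ 2 * 22 := by gcongr
        _ ≤ C ^ 2 * (3 * Real.pi / 2) ^ 2 := by
          have : 22 ≤ (3 * Real.pi / 2) ^ 2 := by nlinarith
          gcongr
        _ = _ := by ring) (fun i => a i) D
  have e1 := Fin.sum_univ_eq_sum_range (fun n => Real.exp (-σ * lam n) ^ 2 * ‖a n‖ ^ 2) N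
  have e2 := Fin.sum_univ_eq_sum_range (fun n => ‖a n‖ ^ 2) N
  have e3 := fun t : ℝ => Fin.sum_univ_eq_sum_range (fun n => a n * (Real.exp (-σ * lam n) : ℂ) *
    Complex.exp (-(lam n * t * Complex.I))) N
  simp only [e1, e2] at h
  refine le_trans (le_of_eq ?_) (h.trans (le_of_eq ?_))
  · refine intervalIntegral.integral_congr fun t _ => ?_
    exact congrArg (fun z => ‖z‖ ^ 2) (e3 t).symm
  · ring

lemma norm_integral_exp_le {D : ℝ} (hD : 0 ≤ D) (x : ℝ) :
    ‖∫ t in (0 : ℝ)..D, Complex.exp (-(x * t * Complex.I))‖ ≤ D ∧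
      (0 < x → ‖∫ t in (0 : ℝ)..D, Complex.exp (-(x * t * Complex.I))‖ ≤ 2 / x) := by
  have hn : ∀ t : ℝ, ‖Complex.exp (-(x * t * Complex.I))‖ = 1 := by
    intro t
    have : -(x * t * Complex.I : ℂ) = ((-(x * t) : ℝ) : ℂ) * Complex.I := by push_cast; ring
    rw [this, Complex.norm_exp_ofReal_mul_I]
  constructor
  · have := intervalIntegral.norm_integral_le_of_norm_le_const (a := 0) (b := D) (C := 1)
      (f := fun t : ℝ => Complex.exp (-(x * t * Complex.I))) (fun t _ => (hn t).le)
    simpa [abs_of_nonneg hD] using this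
  · intro hx
    have e : ∀ t : ℝ, Complex.exp (-(x * t * Complex.I)) =
        Complex.exp (-(x * Complex.I) * t) := fun t => by congr 1; ring
    have hne : -((x : ℂ) * Complex.I) ≠ 0 := by simp [hx.ne']
    have h0 := hn 0
    have hDn := hn D
    rw [e] at h0 hDn
    simp only [e]
    rw [integral_exp_mul_complex hne, norm_div]
    have : ‖-((x : ℂ) * Complex.I)‖ = x := by simp [abs_of_pos hx]
    rw [this]
    gcongr
    refine (norm_sub_le _ _).trans ?_
    rw [h0, hDn]
    norm_num

/-- Comparison of `∑ wₙ² |K(λₙ)|²` with `∫ min (D², 4 / x²)`. -/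
lemma sum_mul_sq_le_of_le_min (lam : ℕ → ℝ) (hlam0 : lam 0 = 0) (hmono : StrictMono lam)
    {D : ℝ} (hD : 0 < D) (K : ℕ → ℝ) (hK0 : ∀ n, 0 ≤ K n) (hKD : ∀ n, K n ≤ D)
    (hK : ∀ n, K n ≤ 2 / lam (n + 1)) (N : ℕ) :
    ∑ n ∈ Finset.range N, (lam (n + 1) - lam n) * K n ^ 2 ≤ 4 * D := by
  have hpos : ∀ n, 0 < lam (n + 1) := fun n => hlam0 ▸ hmono n.succ_pos
  have hnn : ∀ n, 0 ≤ lam n := fun n => hlam0 ▸ hmono.monotone n.zero_le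
  suffices h : (D * lam N ≤ 2 → ∑ n ∈ Finset.range N, (lam (n + 1) - lam n) * K n ^ 2
        ≤ D ^ 2 * lam N) ∧
      (2 < D * lam N → ∑ n ∈ Finset.range N, (lam (n + 1) - lam n) * K n ^ 2
        ≤ 4 * D - 4 / lam N) by
    rcases le_or_gt (D * lam N) 2 with hN | hN
    · have := h.1 hN
      nlinarith
    · have := h.2 hN
      have : 0 ≤ 4 / lam N := div_nonneg (by norm_num) (hnn N)
      linarith
  induction N with
  | zero => simp [hlam0]
  | succ N ih =>
    have hgap : 0 < lam (N + 1) - lam N := sub_pos.2 (hmono N.lt_succ_self)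
    have hb := hpos N
    have ha := hnn N
    rw [Finset.sum_range_succ]
    constructor
    · intro hN
      have h1 := ih.1 (by nlinarith)
      have h2 : K N ^ 2 ≤ D ^ 2 := pow_le_pow_left₀ (hK0 N) (hKD N) 2
      nlinarith
    · intro hN
      have h2 : K N ^ 2 ≤ 4 / lam (N + 1) ^ 2 := by
        have := pow_le_pow_left₀ (hK0 N) (hK N) 2
        rwa [div_pow, show (2 : ℝ) ^ 2 = 4 by norm_num] at this
      have h3 : (lam (N + 1) - lam N) * K N ^ 2 ≤
          (lam (N + 1) - lam N) * (4 / lam (N + 1) ^ 2) := by gcongr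
      rcases le_or_gt (D * lam N) 2 with hc | hc
      · have h1 := ih.1 hc
        have h4 : D ^ 2 * lam N + (lam (N + 1) - lam N) * (4 / lam (N + 1) ^ 2) ≤
            4 * D - 4 / lam (N + 1) := by
          set b := lam (N + 1)
          set l := lam N
          have e : 4 * D - 4 / b - (D ^ 2 * l + (b - l) * (4 / b ^ 2)) =
              ((D * b - 2) * (4 * b - l * (D * b + 2))) / b ^ 2 := by
            field_simp
            ring
          have : 0 ≤ 4 * b - l * (D * b + 2) := by nlinarith
          have : 0 ≤ ((D * b - 2) * (4 * b - l * (D * b + 2))) / b ^ 2 := by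
            apply div_nonneg _ (by positivity)
            apply mul_nonneg _ this
            linarith
          linarith
        linarith
      · have h1 := ih.2 hc
        have ha' : 0 < lam N := by
          rcases ha.eq_or_lt with h | h
          · rw [← h] at hc; norm_num at hc
          · exact h
        have h4 : (lam (N + 1) - lam N) * (4 / lam (N + 1) ^ 2) ≤
            4 / lam N - 4 / lam (N + 1) := by
          set b := lam (N + 1)
          set l := lam N
          have e : 4 / l - 4 / b - (b - l) * (4 / b ^ 2) = 4 * (b - l) ^ 2 / (l * b ^ 2) := by
            field_simp
          have : 0 ≤ 4 * (b - l) ^ 2 / (l * b ^ 2) := by positivity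
          linarith
        linarith

open ComplexConjugate in
/-- The mean value bound for Dirichlet polynomials with positive abscissa. -/
lemma integral_norm_sq_partial_sum_le (lam : ℕ → ℝ) (hlam0 : lam 0 = 0) (hmono : StrictMono lam)
    {C σ : ℝ} (hσ : 0 < σ) (hC : 0 < C)
    (hsep : ∀ n, Real.exp (-σ * (lam n + lam (n + 1))) ≤ C * (lam (n + 1) - lam n))
    (a : ℕ → ℂ) (N : ℕ) {D : ℝ} (hD : 0 < D) :
    ∫ t in (0 : ℝ)..D, ‖∑ n ∈ Finset.range N,
        a n * Real.exp (-σ * lam n) * Complex.exp (-(lam n * t * Complex.I))‖ ^ 2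
      ≤ (D + 3 * Real.pi * C) * ∑ n ∈ Finset.range N, ‖a n‖ ^ 2 := by
  have hnn : ∀ n, 0 ≤ lam n := fun n => hlam0 ▸ hmono.monotone n.zero_le
  rcases le_or_gt (2 * σ) C with hκ | hκ
  · refine (integral_norm_sq_dirichlet_sum_le lam hmono hσ hC hsep (by simpa [hlam0] using hκ)
      a N D).trans ?_
    rw [add_mul]
    gcongr with n _
    refine mul_le_of_le_one_left (by positivity) (pow_le_one₀ (Real.exp_pos _).le ?_)
    rw [Real.exp_le_one_iff]
    nlinarith [hnn n]
  cases N with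
  | zero => simp
  | succ N =>
    set w : ℕ → ℝ := fun n => Real.exp (-σ * lam (n + 1)) with hw
    set e : ℕ → ℝ → ℂ := fun n t => Complex.exp (-(lam (n + 1) * t * Complex.I)) with he
    set S : ℝ → ℂ := fun t => ∑ n ∈ Finset.range N, a (n + 1) * w n * e n t with hS
    set A : ℝ := ∑ n ∈ Finset.range N, ‖a (n + 1)‖ ^ 2 with hA
    have hX1 : C + 2 * σ ≤ C * Real.exp (2 * σ * lam 1) := by
      have h := exp_add_one_le_of_separated hσ hC (hmono Nat.zero_lt_one) (hsep 0)
      rw [hlam0, mul_zero, Real.exp_zero, mul_one, div_add_one (by positivity),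
        div_le_div_iff_of_pos_right (by positivity)] at h
      exact h
    have hS2 : ∫ t in (0 : ℝ)..D, ‖S t‖ ^ 2 ≤ D / 2 * A + 3 * Real.pi * C * A := by
      refine (integral_norm_sq_dirichlet_sum_le (fun n => lam (n + 1))
        (fun i j h => hmono (Nat.succ_lt_succ h)) hσ hC (fun n => hsep (n + 1))
        (by linarith) (fun n => a (n + 1)) N D).trans ?_
      have hhalf : ∀ n : ℕ, Real.exp (-σ * lam (n + 1)) ^ 2 ≤ 1 / 2 := by
        intro n
        have h1 : Real.exp (2 * σ * lam 1) ≤ Real.exp (2 * σ * lam (n + 1)) := by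
          have := hmono.monotone (show 1 ≤ n + 1 by omega)
          gcongr
        have h2 : 2 ≤ Real.exp (2 * σ * lam (n + 1)) := by
          refine le_trans ?_ h1
          by_contra! hlt
          nlinarith
        have h3 : Real.exp (-σ * lam (n + 1)) ^ 2 = (Real.exp (2 * σ * lam (n + 1)))⁻¹ := by
          rw [← Real.exp_nat_mul, ← Real.exp_neg]; congr 1; push_cast; ring
        rw [h3, one_div]
        exact inv_anti₀ (by norm_num) h2
      have h1 : ∑ n ∈ Finset.range N, Real.exp (-σ * lam (n + 1)) ^ 2 * ‖a (n + 1)‖ ^ 2 ≤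
          1 / 2 * A := by
        rw [hA, Finset.mul_sum]
        exact Finset.sum_le_sum fun n _ => mul_le_mul_of_nonneg_right (hhalf n) (by positivity)
      nlinarith
    have hec : ∀ n, Continuous (e n) := fun n => by simp only [he]; fun_prop
    have hSc : Continuous S := by
      simp only [hS]
      exact continuous_finsetSum _ fun n _ => continuous_const.mul (hec n)
    set K : ℕ → ℝ := fun n => ‖∫ t in (0 : ℝ)..D, e n t‖ with hK
    have hJ : ‖∫ t in (0 : ℝ)..D, S t‖ ^ 2 ≤ 4 * C * D * A := by
      have h1 : ‖∫ t in (0 : ℝ)..D, S t‖ ≤ ∑ n ∈ Finset.range N, ‖a (n + 1)‖ * (w n * K n) := by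
        have hSi : ∫ t in (0 : ℝ)..D, S t =
            ∑ n ∈ Finset.range N, ∫ t in (0 : ℝ)..D, a (n + 1) * w n * e n t :=
          intervalIntegral.integral_finsetSum fun n _ =>
            (continuous_const.mul (hec n)).intervalIntegrable _ _
        rw [hSi]
        refine (norm_sum_le _ _).trans (Finset.sum_le_sum fun n _ => ?_)
        rw [intervalIntegral.integral_const_mul, norm_mul, norm_mul, Complex.norm_real,
          Real.norm_of_nonneg (Real.exp_pos _).le, mul_assoc]
      have h2 : ∑ n ∈ Finset.range N, (w n * K n) ^ 2 ≤ C * (4 * D) := by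
        have h3 := sum_mul_sq_le_of_le_min lam hlam0 hmono hD K (fun n => norm_nonneg _)
          (fun n => (norm_integral_exp_le hD.le _).1)
          (fun n => (norm_integral_exp_le hD.le _).2 (hlam0 ▸ hmono n.succ_pos)) N
        refine le_trans ?_ (mul_le_mul_of_nonneg_left h3 hC.le)
        rw [Finset.mul_sum]
        refine Finset.sum_le_sum fun n _ => ?_
        have h4 : w n ^ 2 ≤ C * (lam (n + 1) - lam n) := by
          refine le_trans ?_ (hsep n)
          rw [hw, ← Real.exp_nat_mul]
          apply Real.exp_le_exp.2
          have := hmono n.lt_succ_self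
          push_cast
          nlinarith
        rw [mul_pow, ← mul_assoc]
        gcongr
      calc ‖∫ t in (0 : ℝ)..D, S t‖ ^ 2
          ≤ (∑ n ∈ Finset.range N, ‖a (n + 1)‖ * (w n * K n)) ^ 2 := by gcongr
        _ ≤ A * ∑ n ∈ Finset.range N, (w n * K n) ^ 2 := Finset.sum_mul_sq_le_sq_mul_sq _ _ _
        _ ≤ A * (C * (4 * D)) := by gcongr
        _ = _ := by ring
    have hsplit : ∫ t in (0 : ℝ)..D, ‖a 0 + S t‖ ^ 2 =
        D * ‖a 0‖ ^ 2 + 2 * (conj (a 0) * ∫ t in (0 : ℝ)..D, S t).re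
          + ∫ t in (0 : ℝ)..D, ‖S t‖ ^ 2 := by
      have h1 : ∀ t, ‖a 0 + S t‖ ^ 2 = ‖a 0‖ ^ 2 + 2 * (conj (a 0) * S t).re + ‖S t‖ ^ 2 := by
        intro t
        rw [Complex.sq_norm, Complex.normSq_add, Complex.sq_norm, Complex.sq_norm]
        have : (a 0 * conj (S t)).re = (conj (a 0) * S t).re := by
          simp [Complex.mul_re]
        rw [this]
        ring
      have hc : Continuous fun t => conj (a 0) * S t := continuous_const.mul hSc
      have hcr : Continuous fun t => (conj (a 0) * S t).re := Complex.continuous_re.comp hc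
      simp only [h1]
      rw [intervalIntegral.integral_add, intervalIntegral.integral_add,
        intervalIntegral.integral_const, intervalIntegral.integral_const_mul]
      · have : ∫ t in (0 : ℝ)..D, (conj (a 0) * S t).re =
            (∫ t in (0 : ℝ)..D, conj (a 0) * S t).re :=
          Complex.reCLM.intervalIntegral_comp_comm (hc.intervalIntegrable _ _)
        rw [this, intervalIntegral.integral_const_mul]
        simp
      all_goals exact Continuous.intervalIntegrable (by fun_prop) _ _
    have hcross : (conj (a 0) * ∫ t in (0 : ℝ)..D, S t).re ≤
        ‖a 0‖ * ‖∫ t in (0 : ℝ)..D, S t‖ := by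
      refine (Complex.re_le_norm _).trans ?_
      rw [norm_mul, RCLike.norm_conj]
    have hsum : ∀ t : ℝ, ∑ n ∈ Finset.range (N + 1),
        a n * Real.exp (-σ * lam n) * Complex.exp (-(lam n * t * Complex.I)) = a 0 + S t := by
      intro t
      rw [Finset.sum_range_succ', add_comm]
      simp [hlam0, hS, hw, he]
    simp only [hsum]
    rw [hsplit, Finset.sum_range_succ' _ N, ← hA]
    set J := ‖∫ t in (0 : ℝ)..D, S t‖
    have hamgm : 2 * (‖a 0‖ * J) ≤ 8 * C * ‖a 0‖ ^ 2 + D / 2 * A := by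
      have h1 : J ^ 2 / (8 * C) ≤ D / 2 * A := by
        rw [div_le_iff₀ (by positivity)]; linarith
      have h2 : 8 * C * ‖a 0‖ ^ 2 + J ^ 2 / (8 * C) - 2 * (‖a 0‖ * J) =
          (8 * C * ‖a 0‖ - J) ^ 2 / (8 * C) := by
        field_simp
        ring
      have h3 : 0 ≤ (8 * C * ‖a 0‖ - J) ^ 2 / (8 * C) := by positivity
      linarith
    have hpi : 8 * C * ‖a 0‖ ^ 2 ≤ 3 * Real.pi * C * ‖a 0‖ ^ 2 := by
      have := Real.pi_gt_three
      gcongr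
      linarith
    linarith

/-- The separation condition forces a nonnegative abscissa. -/
lemma abscissa_nonneg_of_separated (lam : ℕ → ℝ) (hlam0 : lam 0 = 0) (hmono : StrictMono lam)
    {C σ : ℝ} (hC : 0 < C)
    (hsep : ∀ σ₁ : ℝ, σ ≤ σ₁ → ∀ n m : ℕ, n ≠ m →
      Real.exp (-σ₁ * (lam n + lam m)) ≤ C * |lam n - lam m|) : 0 ≤ σ := by
  by_contra! hσ
  have hnn : ∀ n, 0 ≤ lam n := fun n => hlam0 ▸ hmono.monotone n.zero_le
  have hgrow : ∀ n : ℕ, n ≤ C * lam n := by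
    intro n
    induction n with
    | zero => simp [hlam0]
    | succ n ih =>
      have h := hsep 0 hσ.le (n + 1) n n.succ_ne_self
      rw [abs_of_pos (sub_pos.2 (hmono n.lt_succ_self))] at h
      simp only [neg_zero, zero_mul, Real.exp_zero] at h
      push_cast
      linarith
  obtain ⟨n, hn⟩ := exists_nat_gt (2 * C ^ 2 / σ ^ 2)
  have hn0 : n ≠ 0 := by
    rintro rfl
    have : 0 ≤ 2 * C ^ 2 / σ ^ 2 := by positivity
    simp at hn
    linarith
  have hpos : 0 < lam n := hlam0 ▸ hmono (Nat.pos_of_ne_zero hn0)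
  have h1 := hsep σ le_rfl n 0 hn0
  rw [hlam0, add_zero, sub_zero, abs_of_pos hpos] at h1
  have h2 : (-σ * lam n) ^ 2 / 2 ≤ Real.exp (-σ * lam n) := by
    have := Real.quadratic_le_exp_of_nonneg (mul_nonneg (neg_nonneg.2 hσ.le) (hnn n))
    have := mul_nonneg (neg_nonneg.2 hσ.le) (hnn n)
    linarith
  have h3 : 2 * C ^ 2 < C * lam n * σ ^ 2 := by
    rw [div_lt_iff₀ (by nlinarith)] at hn
    exact hn.trans_le (mul_le_mul_of_nonneg_right (hgrow n) (sq_nonneg σ))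
  have h4 : σ ^ 2 * lam n * lam n ≤ 2 * C * lam n := by nlinarith
  have h5 : σ ^ 2 * lam n ≤ 2 * C := le_of_mul_le_mul_right h4 hpos
  nlinarith

lemma integral_norm_sq_partial_sum_le_of_nonneg (lam : ℕ → ℝ) (hlam0 : lam 0 = 0)
    (hmono : StrictMono lam) {C σ : ℝ} (hσ : 0 ≤ σ) (hC : 0 < C)
    (hsep : ∀ s, σ ≤ s → ∀ n,
      Real.exp (-s * (lam n + lam (n + 1))) ≤ C * (lam (n + 1) - lam n))
    (a : ℕ → ℂ) (N : ℕ) {D : ℝ} (hD : 0 < D) :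
    ∫ t in (0 : ℝ)..D, ‖∑ n ∈ Finset.range N,
        a n * Real.exp (-σ * lam n) * Complex.exp (-(lam n * t * Complex.I))‖ ^ 2
      ≤ (D + 3 * Real.pi * C) * ∑ n ∈ Finset.range N, ‖a n‖ ^ 2 := by
  have hcont : Continuous fun s : ℝ => ∫ t in (0 : ℝ)..D, ‖∑ n ∈ Finset.range N,
      a n * Real.exp (-s * lam n) * Complex.exp (-(lam n * t * Complex.I))‖ ^ 2 := by
    refine intervalIntegral.continuous_parametric_intervalIntegral_of_continuous' ?_ _ _
    simp only [Function.uncurry_def]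
    fun_prop
  refine le_of_tendsto ((hcont.tendsto σ).mono_left (nhdsWithin_le_nhds (s := Set.Ioi σ))) ?_
  filter_upwards [self_mem_nhdsWithin] with s hs
  exact integral_norm_sq_partial_sum_le lam hlam0 hmono (hσ.trans_lt hs) hC
    (hsep s (le_of_lt hs)) a N hD

open MeasureTheory in
theorem stmt_9 (lam : ℕ → ℝ) (hlam0 : lam 0 = 0) (hmono : StrictMono lam)
    (a : ℕ → ℂ) (ha : Summable fun n => ‖a n‖ ^ 2)
    (C σ : ℝ) (hC : 0 < C)
    (hsep : ∀ σ₁ : ℝ, σ ≤ σ₁ → ∀ n m : ℕ, n ≠ m →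
      Real.exp (-σ₁ * (lam n + lam m)) ≤ C * |lam n - lam m|)
    (D : ℝ) (hD : 0 < D) (σ₁ : ℝ) (hσ₁ : σ ≤ σ₁) :
    ∫ t in (0 : ℝ)..D, ‖∑' n : ℕ, a n * Complex.exp (-(lam n : ℂ) * (σ₁ + t * Complex.I))‖ ^ 2
      ≤ (D + 3 * Real.pi * C) * ∑' n : ℕ, ‖a n‖ ^ 2 := by
  have hσ₀ : 0 ≤ σ₁ := (abscissa_nonneg_of_separated lam hlam0 hmono hC hsep).trans hσ₁
  have hbound : 0 ≤ (D + 3 * Real.pi * C) * ∑' n : ℕ, ‖a n‖ ^ 2 :=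
    mul_nonneg (by positivity) (tsum_nonneg fun n => by positivity)
  have hterm : ∀ (n : ℕ) (t : ℝ), a n * Complex.exp (-(lam n : ℂ) * (σ₁ + t * Complex.I)) =
      a n * Real.exp (-σ₁ * lam n) * Complex.exp (-(lam n * t * Complex.I)) := by
    intro n t
    rw [mul_assoc, Complex.ofReal_exp, ← Complex.exp_add]
    congr 2
    push_cast
    ring
  have hnorm : ∀ (n : ℕ) (t : ℝ), ‖a n * Complex.exp (-(lam n : ℂ) * (σ₁ + t * Complex.I))‖ =
      ‖a n‖ * Real.exp (-σ₁ * lam n) := by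
    intro n t
    rw [norm_mul, Complex.norm_exp]
    congr 2
    simp [mul_comm]
  by_cases hs : Summable fun n => ‖a n‖ * Real.exp (-σ₁ * lam n)
  · have hsum : ∀ t : ℝ, Summable fun n =>
        a n * Complex.exp (-(lam n : ℂ) * (σ₁ + t * Complex.I)) := fun t =>
      Summable.of_norm (by simpa only [hnorm] using hs)
    have hlim := intervalIntegral.tendsto_integral_filter_of_dominated_convergence
      (μ := volume) (a := 0) (b := D) (l := Filter.atTop)
      (F := fun N t => ‖∑ n ∈ Finset.range N,
        a n * Complex.exp (-(lam n : ℂ) * (σ₁ + t * Complex.I))‖ ^ 2)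
      (f := fun t => ‖∑' n : ℕ, a n * Complex.exp (-(lam n : ℂ) * (σ₁ + t * Complex.I))‖ ^ 2)
      (fun _ => (∑' n, ‖a n‖ * Real.exp (-σ₁ * lam n)) ^ 2)
      (Filter.Eventually.of_forall fun N =>
        (Continuous.aestronglyMeasurable (by fun_prop)))
      (Filter.Eventually.of_forall fun N => ae_of_all _ fun t _ => by
        rw [Real.norm_of_nonneg (by positivity)]
        gcongr
        refine (norm_sum_le _ _).trans ?_
        simp only [hnorm]
        exact hs.sum_le_tsum _ fun n _ => by positivity)
      intervalIntegrable_const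
      (ae_of_all _ fun t _ => ((hsum t).hasSum.tendsto_sum_nat.norm.pow 2))
    refine le_of_tendsto' hlim fun N => ?_
    simp only [hterm]
    refine (integral_norm_sq_partial_sum_le_of_nonneg lam hlam0 hmono hσ₀ hC
      (fun s hs n => ?_) a N hD).trans ?_
    · have h := hsep s (hσ₁.trans hs) n (n + 1) n.succ_ne_self.symm
      rwa [abs_sub_comm, abs_of_pos (sub_pos.2 (hmono n.lt_succ_self))] at h
    · gcongr
      exact ha.sum_le_tsum _ fun n _ => by positivity
  · have hzero : ∀ t : ℝ,
        ∑' n : ℕ, a n * Complex.exp (-(lam n : ℂ) * (σ₁ + t * Complex.I)) = 0 := fun t =>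
      tsum_eq_zero_of_not_summable fun h => hs (by simpa only [hnorm] using h.norm)
    simp only [hzero]
    simpa using hbound
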